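/- arXiv:1808.02695 — 7 statements merged into one kernel-verified Lean document; each statement's English description precedes it below -/
import Mathlib

section
/- Let 𝔏 be a Leibniz algebra over a field K of characteristic zero and let n ≥ 2. Then the n-ary bracket defined by [x_1,...,x_n] := [x_1,[x_2,[...,[x_{n-1},x_n]...]]] satisfies the Leibniz n-algebra identity: [[x_1,...,x_n],y_2,...,y_n] = Σ_{i=1}^{n} [x_1,...,x_{i-1},[x_i,y_2,...,y_n],x_{i+1},...,x_n] for all x_1,...,x_n,y_2,...,y_n ∈ 𝔏; that is, U_n(𝔏) is a Leibniz n-algebra. -/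
section Defs

variable {K L : Type*}

/-- Right-nested iterated bracket `[x₀,[x₁,[…,[xₙ₋₁,xₙ]…]]]` built from a binary bracket. -/
def nestedBracket (b : L → L → L) : {n : ℕ} → (Fin (n + 1) → L) → L
  | 0, x => x 0
  | _ + 1, x => b (x 0) (nestedBracket b fun i => x i.succ)

/-- The (right) Leibniz identity for a binary bracket. -/
def IsLeibniz [Add L] (b : L → L → L) : Prop :=
  ∀ x y z, b (b x y) z = b (b x z) y + b x (b y z)

/-- The fundamental identity of a Leibniz `n`-algebra (arity `n + 1`). -/
def LeibnizNIdentity [AddCommMonoid L] {n : ℕ} (br : (Fin (n + 1) → L) → L) : Prop :=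
  ∀ (x : Fin (n + 1) → L) (y : Fin n → L),
    br (Fin.cons (br x) y) =
      ∑ i : Fin (n + 1), br (Function.update x i (br (Fin.cons (x i) y)))

variable [Field K] [AddCommGroup L] [Module K L]

/-- A subspace `I` is an ideal of a Leibniz `n`-algebra: it is an `s`-ideal for every
position `s`, i.e. `[z₁,…,zₙ] ∈ I` whenever some `z_s ∈ I`. -/
def IsNIdeal {n : ℕ} (br : (Fin (n + 1) → L) → L) (I : Submodule K L) : Prop :=
  ∀ (s : Fin (n + 1)) (z : Fin (n + 1) → L), z s ∈ I → br z ∈ I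

/-- The Leibniz `n`-kernel: the smallest ideal containing all brackets with a repeated entry. -/
def leibnizNKernel {n : ℕ} (br : (Fin (n + 1) → L) → L) : Submodule K L :=
  sInf {I : Submodule K L |
    IsNIdeal br I ∧ ∀ z : Fin (n + 1) → L, (∃ i j, i < j ∧ z i = z j) → br z ∈ I}

/-- A subspace `I` is a (two-sided) ideal of a Leibniz algebra. -/
def IsLeibnizIdeal (b : L →ₗ[K] L →ₗ[K] L) (I : Submodule K L) : Prop :=
  (∀ x ∈ I, ∀ y : L, b x y ∈ I) ∧ (∀ x ∈ I, ∀ y : L, b y x ∈ I)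

/-- The Leibniz kernel `span {[x,x] : x ∈ L}` of a Leibniz algebra. -/
def leibnizKernel (b : L →ₗ[K] L →ₗ[K] L) : Submodule K L :=
  Submodule.span K {v : L | ∃ x : L, b x x = v}

/-- The derived series of a subspace of a Leibniz algebra. -/
def derivedSeriesSub (b : L →ₗ[K] L →ₗ[K] L) (S : Submodule K L) : ℕ → Submodule K L
  | 0 => S
  | m + 1 => Submodule.span K
      {v : L | ∃ a ∈ derivedSeriesSub b S m, ∃ c ∈ derivedSeriesSub b S m, b a c = v}

/-- The `k`-derived series `H^{(m+1)_k}` of a subspace of a Leibniz `n`-algebra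
(indexed so that index `0` corresponds to `H^{(1)_k} = H`). -/
def kSeries {n : ℕ} (br : (Fin (n + 1) → L) → L) (k : ℕ) (H : Submodule K L) :
    ℕ → Submodule K L
  | 0 => H
  | p + 1 => Submodule.span K
      {v : L | ∃ z : Fin (n + 1) → L, ∃ s : Finset (Fin (n + 1)),
        k ≤ s.card ∧ (∀ i ∈ s, z i ∈ kSeries br k H p) ∧ br z = v}

end Defs

/-- A derivation of a binary bracket is a derivation of the right-nested bracket. -/
theorem map_nestedBracket_of_derivation {R M : Type*} [CommSemiring R] [AddCommMonoid M]
    [Module R M] (b : M →ₗ[R] M →ₗ[R] M) (D : M → M)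
    (hD : ∀ x y, D (b x y) = b (D x) y + b x (D y)) {n : ℕ} (x : Fin (n + 1) → M) :
    D (nestedBracket (fun x y => b x y) x) =
      ∑ i, nestedBracket (fun x y => b x y) (Function.update x i (D (x i))) := by
  induction n with
  | zero => simp [nestedBracket]
  | succ n ih =>
    have hzero (a : M) : (fun i : Fin (n + 1) => Function.update x 0 a i.succ) =
        fun i => x i.succ := by
      funext i
      simp
    have hsucc (j : Fin (n + 1)) (a : M) :
        (fun i : Fin (n + 1) => Function.update x j.succ a i.succ) =
          Function.update (fun i => x i.succ) j a := by
      funext i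
      simp [Function.update_apply]
    rw [Fin.sum_univ_succ]
    simp only [nestedBracket, hzero, hsucc, Function.update_self, hD, ih, map_sum]
    simp [Function.update_of_ne (Fin.succ_ne_zero _).symm]

/-- For a Leibniz algebra `𝔏` over a field of characteristic zero and `n ≥ 2`
(here arity `= n + 1` with `1 ≤ n`), the right-nested `n`-ary bracket satisfies the
Leibniz `n`-algebra identity; that is, `U_n(𝔏)` is a Leibniz `n`-algebra. -/
theorem stmt_0 {K L : Type*} [Field K] [CharZero K] [AddCommGroup L] [Module K L]
    (b : L →ₗ[K] L →ₗ[K] L) (hb : IsLeibniz fun x y => b x y)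
    (n : ℕ) (hn : 1 ≤ n) :
    LeibnizNIdentity (n := n) (nestedBracket fun x y => b x y) := by
  obtain ⟨m, rfl⟩ := Nat.exists_eq_add_of_le' hn
  intro x y
  have hcons (a : L) : nestedBracket (fun x y => b x y) (Fin.cons a y : Fin (m + 2) → L) =
      b a (nestedBracket (fun x y => b x y) y) := by
    simp [nestedBracket]
  simp only [hcons]
  exact map_nestedBracket_of_derivation b (fun a => b a (nestedBracket (fun x y => b x y) y))
    (fun u v => hb u v _) x
end

section
/- Let L be a Leibniz n-algebra over a field K of characteristic zero and let 1 ≤ i < j ≤ n. Then the subspace I_{ij} = span{[x_1,...,x_n] : x_1,...,x_n ∈ L, x_i = x_j} is a 1-ideal of L; that is, [v,y_2,...,y_n] ∈ I_{ij} for every v ∈ I_{ij} and y_2,...,y_n ∈ L. -/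
/-- Polarization: if `x i = x j`, replacing either of these two entries by `w` and adding the
results lands in the span of the values of `f` at tuples with equal entries at `i` and `j`. -/
theorem MultilinearMap.map_update_add_map_update_mem_span {R ι M N : Type*} [Ring R]
    [DecidableEq ι] [AddCommGroup M] [Module R M] [AddCommGroup N] [Module R N]
    (f : MultilinearMap R (fun _ : ι => M) N) {i j : ι} (hij : i ≠ j) {x : ι → M}
    (hx : x i = x j) (w : M) :
    f (Function.update x i w) + f (Function.update x j w) ∈
      Submodule.span R {v : N | ∃ z : ι → M, z i = z j ∧ f z = v} := by
  let g (a b : M) : N := f (Function.update (Function.update x i a) j b)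
  have diag_mem (a : M) :
      g a a ∈ Submodule.span R {v : N | ∃ z : ι → M, z i = z j ∧ f z = v} :=
    Submodule.subset_span ⟨_, by simp [hij], rfl⟩
  have add_right (a b c : M) : g a (b + c) = g a b + g a c := f.map_update_add _ _ _ _
  have add_left (a b c : M) : g (a + b) c = g a c + g b c := by
    simp only [g, Function.update_comm hij, f.map_update_add]
  have update_left : f (Function.update x i w) = g w (x i) := by
    simp only [g, Function.update_comm hij, hx, Function.update_eq_self]
  have update_right : f (Function.update x j w) = g (x i) w := by
    simp only [g, Function.update_eq_self]
  have polarization :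
      g w (x i) + g (x i) w = g (x i + w) (x i + w) - g (x i) (x i) - g w w := by
    rw [add_left, add_right, add_right]
    abel
  rw [update_left, update_right, polarization]
  exact Submodule.sub_mem _ (Submodule.sub_mem _ (diag_mem _) (diag_mem _)) (diag_mem _)

/-- In a Leibniz `n`-algebra (arity `n + 1`, `1 ≤ n`) over a field of
characteristic zero, for `i < j` the subspace
`I_{ij} = span {[x₁,…,xₙ] : x_i = x_j}` is a `1`-ideal. -/
theorem stmt_1 {K L : Type*} [Field K] [CharZero K] [AddCommGroup L] [Module K L]
    (n : ℕ) (hn : 1 ≤ n)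
    (br : MultilinearMap K (fun _ : Fin (n + 1) => L) L)
    (hbr : LeibnizNIdentity fun z => br z)
    (i j : Fin (n + 1)) (hij : i < j) :
    ∀ v ∈ Submodule.span K {v : L | ∃ z : Fin (n + 1) → L, z i = z j ∧ br z = v},
      ∀ y : Fin n → L,
        br (Fin.cons v y) ∈
          Submodule.span K {v : L | ∃ z : Fin (n + 1) → L, z i = z j ∧ br z = v} := by
  intro v hv y
  induction hv using Submodule.span_induction with
  | mem v hv =>
    obtain ⟨z, hz, rfl⟩ := hv
    have fundamental := hbr z y
    dsimp only at fundamental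
    rw [fundamental, ← Finset.add_sum_erase _ _ (Finset.mem_univ i),
      ← Finset.add_sum_erase _ _ (Finset.mem_erase.mpr ⟨hij.ne', Finset.mem_univ j⟩),
      ← add_assoc]
    refine Submodule.add_mem _ ?_ (Submodule.sum_mem _ fun k hk => ?_)
    · rw [hz]
      exact br.map_update_add_map_update_mem_span hij.ne hz _
    · simp only [Finset.mem_erase, Finset.mem_univ, and_true] at hk
      exact Submodule.subset_span
        ⟨_, by simp [Function.update_of_ne hk.1.symm, Function.update_of_ne hk.2.symm, hz], rfl⟩
  | zero => simp [br.map_coord_zero (m := Fin.cons 0 y) 0]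
  | add u v _ _ hu hv => simpa only [br.cons_add] using Submodule.add_mem _ hu hv
  | smul c v _ hv => simpa only [br.cons_smul] using Submodule.smul_mem _ c hv
end

section
/- Let 𝔏 be a Leibniz algebra over a field K of characteristic zero. A subspace V of 𝔏 is an ideal of the Leibniz 3-algebra U_3(𝔏) if and only if [v,[x,y]] ∈ V and [x,[v,y]] ∈ V for all v ∈ V and x,y ∈ 𝔏. -/
/-- For a Leibniz algebra `𝔏` over a field of characteristic zero, a subspace
`V` is an ideal of the Leibniz `3`-algebra `U₃(𝔏)` (with bracket `[x,y,z] = [x,[y,z]]`)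
if and only if `[v,[x,y]] ∈ V` and `[x,[v,y]] ∈ V` for all `v ∈ V`, `x y ∈ 𝔏`. -/
theorem stmt_4 {K L : Type*} [Field K] [CharZero K] [AddCommGroup L] [Module K L]
    (b : L →ₗ[K] L →ₗ[K] L) (hb : IsLeibniz fun x y => b x y)
    (V : Submodule K L) :
    IsNIdeal (nestedBracket (n := 2) fun x y => b x y) V ↔
      (∀ v ∈ V, ∀ x y : L, b v (b x y) ∈ V) ∧
        (∀ x : L, ∀ v ∈ V, ∀ y : L, b x (b v y) ∈ V) := by
  have nested (z : Fin 3 → L) :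
      nestedBracket (n := 2) (fun x y => b x y) z = b (z 0) (b (z 1) (z 2)) := rfl
  have antisymm (x y z : L) : b x (b y z) = -b x (b z y) := by
    have hyz : b (b x y) z = b (b x z) y + b x (b y z) := hb x y z
    have hzy : b (b x z) y = b (b x y) z + b x (b z y) := hb x z y
    rw [hzy, add_assoc, left_eq_add] at hyz
    exact eq_neg_of_add_eq_zero_right hyz
  constructor
  · intro h
    exact ⟨fun v hv x y => h 0 ![v, x, y] hv, fun x v hv y => h 1 ![x, v, y] hv⟩
  · rintro ⟨hleft, hmid⟩ s z hs
    rw [nested]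
    fin_cases s
    · exact hleft _ hs _ _
    · exact hmid _ _ hs _
    · rw [antisymm]
      exact V.neg_mem (hmid _ _ hs _)
end

section
/- Let 𝔏 be a Leibniz algebra over a field K of characteristic zero. Then the subspace I_{12} = span{[x,[x,y]] : x,y ∈ 𝔏} is an ideal of the Leibniz 3-algebra U_3(𝔏), and it equals the Leibniz 3-kernel Leib_3(U_3(𝔏)). -/
section LeibnizThreeKernel

variable {K L : Type*} [Field K] [AddCommGroup L] [Module K L] {b : L →ₗ[K] L →ₗ[K] L}

theorem IsLeibniz.apply_apply_self (hb : IsLeibniz fun x y => b x y) (x y : L) :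
    b x (b y y) = 0 := by
  simpa using hb x y y

theorem IsLeibniz.apply_apply_swap (hb : IsLeibniz fun x y => b x y) (x y z : L) :
    b x (b y z) = -b x (b z y) := by
  have h := hb.apply_apply_self x (y + z)
  simp only [map_add, LinearMap.add_apply, hb.apply_apply_self, zero_add, add_zero] at h
  exact eq_neg_of_add_eq_zero_right h

/-- The bracket `[x,[y,z]]` is antisymmetric in `x`, `y` modulo the span of all `[x,[x,y]]`. -/
theorem apply_apply_add_swap_mem (x y z : L) :
    b x (b y z) + b y (b x z) ∈ Submodule.span K {v : L | ∃ x y : L, b x (b x y) = v} := by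
  have h (u : L) : b u (b u z) ∈ Submodule.span K {v : L | ∃ x y : L, b x (b x y) = v} :=
    Submodule.subset_span ⟨u, z, rfl⟩
  have h' := sub_mem (sub_mem (h (x + y)) (h x)) (h y)
  simp only [map_add, LinearMap.add_apply] at h'
  convert h' using 1
  abel

/-- The span of all `[x,[x,y]]` is a right ideal of the Leibniz algebra. -/
theorem IsLeibniz.apply_mem_span (hb : IsLeibniz fun x y => b x y) {v : L}
    (hv : v ∈ Submodule.span K {v : L | ∃ x y : L, b x (b x y) = v}) (c : L) :
    b v c ∈ Submodule.span K {v : L | ∃ x y : L, b x (b x y) = v} := by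
  induction hv using Submodule.span_induction with
  | mem v h =>
    obtain ⟨x, y, rfl⟩ := h
    have h₁ : b (b x (b x y)) c = b (b x c) (b x y) + b x (b (b x y) c) := hb x (b x y) c
    have h₂ : b (b x y) c = b (b x c) y + b x (b y c) := hb x y c
    rw [h₁, h₂, map_add, ← add_assoc]
    exact add_mem (apply_apply_add_swap_mem _ _ _) (Submodule.subset_span ⟨_, _, rfl⟩)
  | zero => simp
  | add u v _ _ hu hv => simpa using add_mem hu hv
  | smul a v _ hv => simpa using Submodule.smul_mem _ a hv

theorem IsLeibniz.isNIdeal_span (hb : IsLeibniz fun x y => b x y) :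
    IsNIdeal (nestedBracket (n := 2) fun x y => b x y)
      (Submodule.span K {v : L | ∃ x y : L, b x (b x y) = v}) := by
  intro s z hz
  change b (z 0) (b (z 1) (z 2)) ∈ _
  have middle {v : L} (hv : v ∈ Submodule.span K {v : L | ∃ x y : L, b x (b x y) = v})
      (x y : L) : b x (b v y) ∈ Submodule.span K {v : L | ∃ x y : L, b x (b x y) = v} :=
    (Submodule.add_mem_iff_left _ (hb.apply_mem_span hv _)).1 (apply_apply_add_swap_mem x v y)
  fin_cases s
  · exact hb.apply_mem_span hz _
  · exact middle hz _ _
  · rw [hb.apply_apply_swap]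
    exact neg_mem (middle hz _ _)

theorem IsLeibniz.nestedBracket_mem_span (hb : IsLeibniz fun x y => b x y) {z : Fin 3 → L}
    (hz : ∃ i j, i < j ∧ z i = z j) :
    nestedBracket (n := 2) (fun x y => b x y) z ∈
      Submodule.span K {v : L | ∃ x y : L, b x (b x y) = v} := by
  change b (z 0) (b (z 1) (z 2)) ∈ _
  have h : z 0 = z 1 ∨ z 0 = z 2 ∨ z 1 = z 2 := by
    obtain ⟨i, j, hij, h⟩ := hz
    fin_cases i <;> fin_cases j <;> simp_all
  rcases h with h | h | h
  · exact Submodule.subset_span ⟨z 1, z 2, by rw [h]⟩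
  · rw [hb.apply_apply_swap, h]
    exact neg_mem (Submodule.subset_span ⟨z 2, z 1, rfl⟩)
  · rw [h, hb.apply_apply_self]
    exact zero_mem _

end LeibnizThreeKernel

/-- For a Leibniz algebra `𝔏` over a field of characteristic zero, the subspace
`I₁₂ = span {[x,[x,y]] : x, y ∈ 𝔏}` is an ideal of the Leibniz `3`-algebra `U₃(𝔏)` and is
equal to the Leibniz `3`-kernel of `U₃(𝔏)`. -/
theorem stmt_5 {K L : Type*} [Field K] [CharZero K] [AddCommGroup L] [Module K L]
    (b : L →ₗ[K] L →ₗ[K] L) (hb : IsLeibniz fun x y => b x y) :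
    IsNIdeal (nestedBracket (n := 2) fun x y => b x y)
        (Submodule.span K {v : L | ∃ x y : L, b x (b x y) = v}) ∧
      Submodule.span K {v : L | ∃ x y : L, b x (b x y) = v} =
        leibnizNKernel (K := K) (nestedBracket (n := 2) fun x y => b x y) := by
  refine ⟨hb.isNIdeal_span, le_antisymm ?_ ?_⟩
  · refine le_sInf fun I hI => Submodule.span_le.2 ?_
    rintro _ ⟨x, y, rfl⟩
    exact hI.2 ![x, x, y] ⟨0, 1, by decide, rfl⟩
  · exact sInf_le ⟨hb.isNIdeal_span, fun _ hz => hb.nestedBracket_mem_span hz⟩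
end

section
/- Let L be a finite-dimensional Leibniz n-algebra (n ≥ 2) over a field K of characteristic zero. If there exist a_2,...,a_n ∈ L such that the right multiplication operator R[a] : L → L, R[a](z) = [z,a_2,...,a_n], is bijective, then the Leibniz n-kernel Leib_n(L) equals L. -/
/-- A finite-dimensional Leibniz `n`-algebra (arity `n + 1`, `1 ≤ n`) over a
field of characteristic zero admitting a bijective right multiplication operator
`R[a](z) = [z,a₂,…,aₙ]` satisfies `Leibₙ(L) = L`. -/
theorem stmt_7 {K L : Type*} [Field K] [CharZero K] [AddCommGroup L] [Module K L]
    [FiniteDimensional K L]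
    (n : ℕ) (hn : 1 ≤ n)
    (br : MultilinearMap K (fun _ : Fin (n + 1) => L) L)
    (hbr : LeibnizNIdentity fun z => br z)
    (a : Fin n → L)
    (ha : Function.Bijective fun z : L => br (Fin.cons z a)) :
    leibnizNKernel (K := K) (fun z => br z) = ⊤ := by
  rw [leibnizNKernel, sInf_eq_top]
  rintro I ⟨hI, hrep⟩
  let R : L →ₗ[K] L := br.toLinearMap (Fin.cons 0 a) 0
  have hR (z : L) : R z = br (Fin.cons z a) := by
    simp [R, MultilinearMap.toLinearMap_apply, Fin.update_cons_zero]
  have hRI : ∀ x ∈ I, R x ∈ I := fun x hx => by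
    rw [hR]
    exact hI 0 _ (by simpa using hx)
  have hsurj : Function.Surjective (R.restrict hRI) := by
    rw [← LinearMap.injective_iff_surjective]
    intro x y hxy
    refine Subtype.ext (ha.1 ?_)
    simpa [hR] using congrArg Subtype.val hxy
  let k : Fin n := ⟨0, hn⟩
  have hmem : R (a k) ∈ I := by
    rw [hR]
    exact hrep _ ⟨0, k.succ, Fin.succ_pos k, by simp⟩
  have hak : a k ∈ I := by
    obtain ⟨w, hw⟩ := hsurj ⟨_, hmem⟩
    have hwk : (w : L) = a k := ha.1 (by simpa [hR] using congrArg Subtype.val hw)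
    exact hwk ▸ w.2
  refine (Submodule.eq_top_iff').2 fun x => ?_
  obtain ⟨z, rfl⟩ := ha.2 x
  exact hI k.succ _ (by simpa using hak)
end

section
/- Let 𝔏 be a finite-dimensional semisimple Leibniz algebra over an algebraically closed field K of characteristic zero and let n ≥ 3. Then the Leibniz n-kernel of U_n(𝔏) is all of 𝔏: Leib_n(U_n(𝔏)) = 𝔏. -/
section LieAlgebraFacts

variable {K g : Type*} [Field K] [CharZero K] [LieRing g] [LieAlgebra K g]
  [FiniteDimensional K g] [LieAlgebra.HasTrivialRadical K g]

/-- In a semisimple Lie algebra, an ideal containing all `⁅x, ⁅x, w⁆⁆` is everything. -/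
theorem LieIdeal.eq_top_of_lie_lie_self_mem (I : LieIdeal K g)
    (hI : ∀ x w : g, ⁅x, ⁅x, w⁆⁆ ∈ I) : I = ⊤ := by
  obtain ⟨J, hJ⟩ := exists_isCompl I
  have hnil : LieRing.IsNilpotent J := by
    rw [LieAlgebra.isNilpotent_iff_forall (R := K)]
    intro x
    refine ⟨2, ?_⟩
    ext w
    have hmem : ⁅(x : g), ⁅(x : g), (w : g)⁆⁆ ∈ I ⊓ J :=
      ⟨hI _ _, J.lie_mem (J.lie_mem w.2)⟩
    rw [hJ.inf_eq_bot, LieSubmodule.mem_bot] at hmem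
    simpa [pow_two] using hmem
  have hsol : LieAlgebra.IsSolvable J := inferInstance
  have hbot : J = ⊥ := LieAlgebra.HasTrivialRadical.eq_bot_of_isSolvable (R := K) J
  simpa [hbot] using hJ.sup_eq_top

/-- A subspace of a semisimple Lie algebra containing all brackets is everything. -/
theorem Submodule.eq_top_of_lie_mem (S : Submodule K g) (hS : ∀ x y : g, ⁅x, y⁆ ∈ S) :
    S = ⊤ := by
  let I : LieIdeal K g := { S with lie_mem := fun _ => hS _ _ }
  have hI : I = ⊤ := I.eq_top_of_lie_lie_self_mem fun _ _ => hS _ _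
  exact eq_top_iff.2 fun x _ => (show x ∈ I from hI ▸ LieSubmodule.mem_top x)

end LieAlgebraFacts

section LeibnizFacts

variable {K L : Type*} [Field K] [AddCommGroup L] [Module K L] {b : L →ₗ[K] L →ₗ[K] L}

theorem bracket_self_mem_leibnizKernel (b : L →ₗ[K] L →ₗ[K] L) (x : L) :
    b x x ∈ leibnizKernel b :=
  Submodule.subset_span ⟨x, rfl⟩

theorem bracket_add_bracket_swap_mem_leibnizKernel (b : L →ₗ[K] L →ₗ[K] L) (x y : L) :
    b x y + b y x ∈ leibnizKernel b := by
  have h : b x y + b y x = b (x + y) (x + y) - b x x - b y y := by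
    simp only [map_add, LinearMap.add_apply]; abel
  rw [h]
  exact sub_mem (sub_mem (bracket_self_mem_leibnizKernel b _)
    (bracket_self_mem_leibnizKernel b _)) (bracket_self_mem_leibnizKernel b _)

theorem bracket_eq_zero_of_mem_leibnizKernel (hb : IsLeibniz fun x y => b x y) (x : L) {v : L}
    (hv : v ∈ leibnizKernel b) : b x v = 0 := by
  have hle : leibnizKernel b ≤ LinearMap.ker (b x) := by
    refine Submodule.span_le.2 ?_
    rintro _ ⟨y, rfl⟩
    simpa using hb x y y
  exact hle hv

theorem bracket_mem_leibnizKernel (hb : IsLeibniz fun x y => b x y) {v : L}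
    (hv : v ∈ leibnizKernel b) (y : L) : b v y ∈ leibnizKernel b := by
  have h := bracket_add_bracket_swap_mem_leibnizKernel b v y
  rwa [bracket_eq_zero_of_mem_leibnizKernel hb y hv, add_zero] at h

/-- The bracket induced on the quotient by the Leibniz kernel. -/
def quotientBracket (b : L →ₗ[K] L →ₗ[K] L) (hb : IsLeibniz fun x y => b x y) :
    (L ⧸ leibnizKernel b) →ₗ[K] (L ⧸ leibnizKernel b) →ₗ[K] (L ⧸ leibnizKernel b) :=
  (leibnizKernel b).liftQ
    (((leibnizKernel b).liftQ (b.compr₂ (leibnizKernel b).mkQ).flip (fun v hv => by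
      ext x
      simp [bracket_eq_zero_of_mem_leibnizKernel hb x hv])).flip) (fun v hv => by
      ext y
      exact (Submodule.Quotient.mk_eq_zero _).2 (bracket_mem_leibnizKernel hb hv y))

theorem quotientBracket_mk (hb : IsLeibniz fun x y => b x y) (x y : L) :
    quotientBracket b hb ((leibnizKernel b).mkQ x) ((leibnizKernel b).mkQ y) =
      (leibnizKernel b).mkQ (b x y) := rfl

/-- The quotient of a Leibniz algebra by its Leibniz kernel is a Lie ring. -/
abbrev quotientLieRing (b : L →ₗ[K] L →ₗ[K] L) (hb : IsLeibniz fun x y => b x y) :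
    LieRing (L ⧸ leibnizKernel b) where
  bracket u v := quotientBracket b hb u v
  add_lie u v w := by simp
  lie_add u v w := by simp
  lie_self u := by
    obtain ⟨x, rfl⟩ := (leibnizKernel b).mkQ_surjective u
    change quotientBracket b hb _ _ = 0
    rw [quotientBracket_mk]
    simpa using bracket_self_mem_leibnizKernel b x
  leibniz_lie u v w := by
    obtain ⟨x, rfl⟩ := (leibnizKernel b).mkQ_surjective u
    obtain ⟨y, rfl⟩ := (leibnizKernel b).mkQ_surjective v
    obtain ⟨z, rfl⟩ := (leibnizKernel b).mkQ_surjective w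
    change quotientBracket b hb _ (quotientBracket b hb _ _) =
      quotientBracket b hb (quotientBracket b hb _ _) _ +
        quotientBracket b hb _ (quotientBracket b hb _ _)
    simp only [quotientBracket_mk]
    rw [← map_add, ← sub_eq_zero, ← map_sub]
    have h := hb x y z
    dsimp only at h
    have e : b x (b y z) - (b (b x y) z + b y (b x z)) =
        -(b (b x z) y + b y (b x z)) := by
      rw [h]; abel
    rw [e]
    exact (Submodule.Quotient.mk_eq_zero _).2
      (neg_mem (bracket_add_bracket_swap_mem_leibnizKernel b (b x z) y))

/-- The quotient of a Leibniz algebra by its Leibniz kernel is a Lie algebra. -/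
abbrev quotientLieAlgebra (b : L →ₗ[K] L →ₗ[K] L) (hb : IsLeibniz fun x y => b x y) :
    letI := quotientLieRing b hb
    LieAlgebra K (L ⧸ leibnizKernel b) :=
  letI := quotientLieRing b hb
  { lie_smul := fun t u v => (quotientBracket b hb u).map_smul t v }

/-- If a subspace `S` covers `L` modulo the Leibniz kernel and `L` is perfect, then the
brackets `[x, s]` with `s ∈ S` span `L`. -/
theorem eq_top_of_bracket_mem (hb : IsLeibniz fun x y => b x y)
    (hperf : ∀ A : Submodule K L, (∀ x y, b x y ∈ A) → A = ⊤) {S A : Submodule K L}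
    (hS : S ⊔ leibnizKernel b = ⊤) (hA : ∀ x, ∀ s ∈ S, b x s ∈ A) : A = ⊤ := by
  refine hperf A fun x y => ?_
  obtain ⟨s, hs, v, hv, rfl⟩ := Submodule.mem_sup.1 (hS ▸ Submodule.mem_top : y ∈ _)
  rw [map_add, bracket_eq_zero_of_mem_leibnizKernel hb x hv, add_zero]
  exact hA x s hs

/-- In a perfect Leibniz algebra, the iterated brackets with last entry in a subspace `S`
covering `L` modulo the Leibniz kernel span `L`, modulo the Leibniz kernel in length one. -/
theorem nestedBracket_span (hb : IsLeibniz fun x y => b x y)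
    (hperf : ∀ A : Submodule K L, (∀ x y, b x y ∈ A) → A = ⊤) {S : Submodule K L}
    (hS : S ⊔ leibnizKernel b = ⊤) (n : ℕ) (A : Submodule K L)
    (hA : ∀ z : Fin (n + 1) → L, z (Fin.last n) ∈ S →
      nestedBracket (fun x y => b x y) z ∈ A) :
    A ⊔ leibnizKernel b = ⊤ ∧ (n ≠ 0 → A = ⊤) := by
  induction n generalizing A with
  | zero =>
    have hSA : S ≤ A := fun s hs => hA (fun _ => s) hs
    exact ⟨top_le_iff.1 (hS ▸ sup_le_sup_right hSA _), fun h => absurd rfl h⟩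
  | succ n ih =>
    let T := Submodule.span K {v : L | ∃ z : Fin (n + 1) → L, z (Fin.last n) ∈ S ∧
      nestedBracket (fun x y => b x y) z = v}
    have hT : T ⊔ leibnizKernel b = ⊤ :=
      (ih T fun z hz => Submodule.subset_span ⟨z, hz, rfl⟩).1
    have hAtop : A = ⊤ := by
      refine eq_top_of_bracket_mem hb hperf hT fun x s hs => ?_
      have hle : T ≤ A.comap (b x) := by
        refine Submodule.span_le.2 ?_
        rintro _ ⟨z, hz, rfl⟩
        refine hA (Fin.cons x z) ?_
        rwa [← Fin.succ_last, Fin.cons_succ]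
      exact hle hs
    exact ⟨by rw [hAtop, top_sup_eq], fun _ => hAtop⟩

theorem eq_top_of_nestedBracket_mem (hb : IsLeibniz fun x y => b x y)
    (hperf : ∀ A : Submodule K L, (∀ x y, b x y ∈ A) → A = ⊤) (n : ℕ) (A : Submodule K L)
    (hA : ∀ z : Fin (n + 1) → L, nestedBracket (fun x y => b x y) z ∈ A) (hn : n ≠ 0) :
    A = ⊤ :=
  (nestedBracket_span hb hperf (S := ⊤) (top_sup_eq _) n A fun z _ => hA z).2 hn

/-- The Lie quotient of a semisimple Leibniz algebra has trivial radical. -/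
theorem hasTrivialRadical_quotient (hb : IsLeibniz fun x y => b x y)
    (hss : ∀ I : Submodule K L, IsLeibnizIdeal b I →
      (∃ m, derivedSeriesSub b I m = ⊥) → I ≤ leibnizKernel b) :
    letI := quotientLieRing b hb
    letI := quotientLieAlgebra b hb
    LieAlgebra.HasTrivialRadical K (L ⧸ leibnizKernel b) := by
  let := quotientLieRing b hb
  let := quotientLieAlgebra b hb
  rw [LieAlgebra.hasTrivialRadical_iff_no_abelian_ideals]
  intro J hJ
  let I : Submodule K L := J.toSubmodule.comap (leibnizKernel b).mkQ
  have hmemL (x : L) (hx : x ∈ I) (y : L) : b y x ∈ I :=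
    J.lie_mem (x := (leibnizKernel b).mkQ y) hx
  have hmemR (x : L) (hx : x ∈ I) (y : L) : b x y ∈ I :=
    lie_mem_left K _ J _ ((leibnizKernel b).mkQ y) hx
  have hD : derivedSeriesSub b I 1 ≤ leibnizKernel b := by
    refine Submodule.span_le.2 ?_
    rintro _ ⟨x, hx, y, hy, rfl⟩
    have h0 : ⁅(⟨_, hx⟩ : J), (⟨_, hy⟩ : J)⁆ = 0 := trivial_lie_zero J J _ _
    have h1 : (leibnizKernel b).mkQ (b x y) = 0 := congrArg Subtype.val h0
    simpa using h1
  have hle : I ≤ leibnizKernel b := by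
    refine hss I ⟨hmemR, hmemL⟩ ⟨2, ?_⟩
    refine Submodule.span_eq_bot.2 ?_
    rintro _ ⟨x, -, y, hy, rfl⟩
    exact bracket_eq_zero_of_mem_leibnizKernel hb x (hD hy)
  rw [eq_bot_iff]
  intro u hu
  obtain ⟨x, rfl⟩ := (leibnizKernel b).mkQ_surjective u
  rw [LieSubmodule.mem_bot]
  simpa using hle hu

variable [CharZero K] [FiniteDimensional K L]

/-- A subspace of a semisimple Leibniz algebra containing all brackets is everything. -/
theorem eq_top_of_forall_bracket_mem (hb : IsLeibniz fun x y => b x y)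
    (hss : ∀ I : Submodule K L, IsLeibnizIdeal b I →
      (∃ m, derivedSeriesSub b I m = ⊥) → I ≤ leibnizKernel b)
    (A : Submodule K L) (hA : ∀ x y, b x y ∈ A) : A = ⊤ := by
  let := quotientLieRing b hb
  let := quotientLieAlgebra b hb
  have := hasTrivialRadical_quotient hb hss
  have hker : leibnizKernel b ≤ A := by
    refine Submodule.span_le.2 ?_
    rintro _ ⟨x, rfl⟩
    exact hA x x
  have hmap : A.map (leibnizKernel b).mkQ = ⊤ := by
    refine Submodule.eq_top_of_lie_mem _ fun u v => ?_
    obtain ⟨x, rfl⟩ := (leibnizKernel b).mkQ_surjective u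
    obtain ⟨y, rfl⟩ := (leibnizKernel b).mkQ_surjective v
    exact Submodule.mem_map_of_mem (hA x y)
  have h := Submodule.comap_map_mkQ (leibnizKernel b) A
  rwa [hmap, Submodule.comap_top, sup_eq_right.2 hker, eq_comm] at h

/-- A right ideal of a semisimple Leibniz algebra containing all `[x,[x,w]]` is everything
modulo the Leibniz kernel. -/
theorem sup_leibnizKernel_eq_top (hb : IsLeibniz fun x y => b x y)
    (hss : ∀ I : Submodule K L, IsLeibnizIdeal b I →
      (∃ m, derivedSeriesSub b I m = ⊥) → I ≤ leibnizKernel b)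
    (I : Submodule K L) (hI : ∀ z ∈ I, ∀ w, b z w ∈ I) (hrep : ∀ x w, b x (b x w) ∈ I) :
    I ⊔ leibnizKernel b = ⊤ := by
  let := quotientLieRing b hb
  let := quotientLieAlgebra b hb
  have := hasTrivialRadical_quotient hb hss
  let J : LieIdeal K (L ⧸ leibnizKernel b) :=
    { I.map (leibnizKernel b).mkQ with
      lie_mem := by
        rintro u _ ⟨z, hz, rfl⟩
        obtain ⟨w, rfl⟩ := (leibnizKernel b).mkQ_surjective u
        rw [← lie_skew]
        exact neg_mem (S := Submodule K (L ⧸ leibnizKernel b))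
          (Submodule.mem_map_of_mem (hI z hz w)) }
  have hJ : J = ⊤ := by
    refine J.eq_top_of_lie_lie_self_mem fun u v => ?_
    obtain ⟨x, rfl⟩ := (leibnizKernel b).mkQ_surjective u
    obtain ⟨y, rfl⟩ := (leibnizKernel b).mkQ_surjective v
    exact Submodule.mem_map_of_mem (hrep x y)
  have hmap : I.map (leibnizKernel b).mkQ = ⊤ := by
    simpa [J] using congrArg LieSubmodule.toSubmodule hJ
  rw [sup_comm, ← Submodule.comap_map_mkQ, hmap, Submodule.comap_top]

end LeibnizFacts

/-- For a finite-dimensional semisimple Leibniz algebra `𝔏` over an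
algebraically closed field of characteristic zero and `n ≥ 3` (arity `n + 1` with `2 ≤ n`),
the Leibniz `n`-kernel of `U_n(𝔏)` is all of `𝔏`. -/
theorem stmt_8 {K L : Type*} [Field K] [IsAlgClosed K] [CharZero K]
    [AddCommGroup L] [Module K L] [FiniteDimensional K L]
    (b : L →ₗ[K] L →ₗ[K] L) (hb : IsLeibniz fun x y => b x y)
    (hss : ∀ I : Submodule K L, IsLeibnizIdeal b I →
      (∃ m, derivedSeriesSub b I m = ⊥) → I ≤ leibnizKernel b)
    (n : ℕ) (hn : 2 ≤ n) :
    leibnizNKernel (K := K) (nestedBracket (n := n) fun x y => b x y) = ⊤ := by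
  obtain ⟨m, rfl⟩ : ∃ m, n = m + 2 := ⟨n - 2, by omega⟩
  have hperf := eq_top_of_forall_bracket_mem hb hss
  refine sInf_eq_top.2 fun I ⟨hI, hrep⟩ => ?_
  have hright : ∀ z ∈ I, ∀ w, b z w ∈ I := fun z hz w => by
    have h : I.comap (b z) = ⊤ :=
      eq_top_of_nestedBracket_mem hb hperf (m + 1) _
        (fun y => hI 0 (Fin.cons z y) hz) m.succ_ne_zero
    exact (h ▸ Submodule.mem_top : w ∈ I.comap (b z))
  have hself : ∀ x w, b x (b x w) ∈ I := fun x w => by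
    have h : I.comap (b x ∘ₗ b x) ⊔ leibnizKernel b = ⊤ :=
      (nestedBracket_span hb hperf (S := ⊤) (top_sup_eq _) m _
        fun y _ => hrep (Fin.cons x (Fin.cons x y)) ⟨0, 1, by simp, rfl⟩).1
    obtain ⟨u, hu, v, hv, rfl⟩ := Submodule.mem_sup.1 (h ▸ Submodule.mem_top : w ∈ _)
    rw [map_add, bracket_eq_zero_of_mem_leibnizKernel hb x hv, add_zero]
    exact hu
  exact (nestedBracket_span hb hperf (sup_leibnizKernel_eq_top hb hss I hright hself) (m + 2) I
    fun z hz => hI _ z hz).2 (by omega)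
end

section
/- Let 𝔏 be a finite-dimensional Leibniz algebra over a field K of characteristic zero which is not a Lie algebra (i.e., Leib(𝔏) ≠ {0}), let n ≥ 2, and suppose the Leibniz n-algebra U_n(𝔏) admits exactly one ideal different from {0} and 𝔏. Then 𝔏 is a simple Leibniz algebra (its only ideals are {0}, Leib(𝔏) and 𝔏) and the unique nontrivial ideal of U_n(𝔏) is Leib(𝔏). -/
section LeibnizIdeals

variable {K L : Type*} [Field K] [AddCommGroup L] [Module K L]

/-- A two-sided ideal of a binary bracket is an ideal for every nested bracket. -/
theorem IsLeibnizIdeal.isNIdeal {b : L →ₗ[K] L →ₗ[K] L} {I : Submodule K L}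
    (hI : IsLeibnizIdeal b I) (n : ℕ) :
    IsNIdeal (nestedBracket (n := n) fun a c => b a c) I := by
  induction n with
  | zero =>
    intro s z hz
    rw [Fin.fin_one_eq_zero s] at hz
    exact hz
  | succ n ih =>
    intro s z
    refine Fin.cases (fun hz => ?_) (fun j hz => ?_) s
    · exact hI.1 _ hz _
    · exact hI.2 _ (ih j (fun i => z i.succ) hz) _

/-- Right multiplication by an element of the Leibniz kernel is zero. -/
theorem IsLeibniz.apply_eq_zero_of_mem_leibnizKernel {b : L →ₗ[K] L →ₗ[K] L}
    (hb : IsLeibniz fun x y => b x y) {v : L} (hv : v ∈ leibnizKernel b) (y : L) :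
    b y v = 0 := by
  have hle : leibnizKernel b ≤ LinearMap.ker (b y) := by
    refine Submodule.span_le.2 ?_
    rintro _ ⟨x, rfl⟩
    simpa using hb y x x
  exact hle hv

/-- The Leibniz kernel is a two-sided ideal. -/
theorem IsLeibniz.isLeibnizIdeal_leibnizKernel {b : L →ₗ[K] L →ₗ[K] L}
    (hb : IsLeibniz fun x y => b x y) : IsLeibnizIdeal b (leibnizKernel b) := by
  refine ⟨fun v hv y => ?_, fun v hv y => ?_⟩
  · have hle : leibnizKernel b ≤ (leibnizKernel b).comap (b.flip y) := by
      refine Submodule.span_le.2 ?_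
      rintro _ ⟨x, rfl⟩
      have hsq (w : L) : b w w ∈ leibnizKernel b := Submodule.subset_span ⟨w, rfl⟩
      have hpol : b (b x x) y = b (x + b x y) (x + b x y) - b x x - b (b x y) (b x y) := by
        have h : b (b x x) y = b (b x y) x + b x (b x y) := hb x x y
        rw [h]
        simp only [map_add, LinearMap.add_apply]
        abel
      change b (b x x) y ∈ leibnizKernel b
      rw [hpol]
      exact sub_mem (sub_mem (hsq _) (hsq _)) (hsq _)
    exact hle hv
  · rw [hb.apply_eq_zero_of_mem_leibnizKernel hv y]
    exact zero_mem _

/-- The Leibniz kernel of a non-Lie Leibniz algebra is a proper subspace. -/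
theorem IsLeibniz.leibnizKernel_ne_top {b : L →ₗ[K] L →ₗ[K] L}
    (hb : IsLeibniz fun x y => b x y) (hne : leibnizKernel b ≠ ⊥) :
    leibnizKernel b ≠ ⊤ := by
  intro htop
  refine hne (Submodule.span_eq_bot.2 ?_)
  rintro _ ⟨x, rfl⟩
  exact hb.apply_eq_zero_of_mem_leibnizKernel (htop ▸ Submodule.mem_top) x

end LeibnizIdeals

/-- Let `𝔏` be a finite-dimensional non-Lie Leibniz algebra (`Leib(𝔏) ≠ ⊥`)
over a field of characteristic zero, `n ≥ 2` (arity `n + 1`, `1 ≤ n`), and suppose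
`U_n(𝔏)` admits exactly one ideal different from `⊥` and `⊤`. Then `𝔏` is a simple Leibniz
algebra (its only ideals are `⊥`, `Leib(𝔏)`, `⊤`) and the unique nontrivial ideal of
`U_n(𝔏)` is `Leib(𝔏)`. -/
theorem stmt_14 {K L : Type*} [Field K] [CharZero K] [AddCommGroup L] [Module K L]
    [FiniteDimensional K L]
    (b : L →ₗ[K] L →ₗ[K] L) (hb : IsLeibniz fun x y => b x y)
    (hnonLie : leibnizKernel b ≠ ⊥)
    (n : ℕ) (hn : 1 ≤ n)
    (huniq : ∃! I : Submodule K L,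
      IsNIdeal (nestedBracket (n := n) fun a c => b a c) I ∧ I ≠ ⊥ ∧ I ≠ ⊤) :
    (∀ I : Submodule K L, IsLeibnizIdeal b I →
        I = ⊥ ∨ I = leibnizKernel b ∨ I = ⊤) ∧
      (IsNIdeal (nestedBracket (n := n) fun a c => b a c) (leibnizKernel b) ∧
        leibnizKernel b ≠ ⊥ ∧ leibnizKernel b ≠ ⊤) := by
  have hker := hb.isLeibnizIdeal_leibnizKernel.isNIdeal n
  have htop := hb.leibnizKernel_ne_top hnonLie
  refine ⟨fun I hI => ?_, hker, hnonLie, htop⟩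
  by_cases hbot : I = ⊥
  · exact Or.inl hbot
  by_cases hI_top : I = ⊤
  · exact Or.inr (Or.inr hI_top)
  exact Or.inr (Or.inl
    (huniq.unique ⟨hI.isNIdeal n, hbot, hI_top⟩ ⟨hker, hnonLie, htop⟩))
end
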